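/- arXiv:2210.11110 — 2 statements merged into one kernel-verified Lean document; each statement's English description precedes it below -/
import Mathlib

section
/- Endow ℤ with the Khalimsky topology. A subset X ⊆ ℤ is connected if and only if X is an interval, i.e., whenever a, b ∈ X and a ≤ c ≤ b, then c ∈ X. -/
/-- The Khalimsky (digital line) topology on `ℤ`, generated by the sets `{2k+1}` and
`{2k-1, 2k, 2k+1}`, `k ∈ ℤ`. -/
def khalimskyTop : TopologicalSpace ℤ :=
  TopologicalSpace.generateFrom
    {S : Set ℤ | ∃ k : ℤ, S = {2 * k + 1} ∨ S = {2 * k - 1, 2 * k, 2 * k + 1}}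

open scoped Topology

theorem isOpen_khalimskyTop_iff (U : Set ℤ) :
    IsOpen[khalimskyTop] U ↔ ∀ k : ℤ, 2 * k ∈ U → 2 * k - 1 ∈ U ∧ 2 * k + 1 ∈ U := by
  constructor
  · intro hU
    induction hU with
    | basic S hS =>
      obtain ⟨j, rfl | rfl⟩ := hS <;> intro k hk <;>
        simp only [Set.mem_insert_iff, Set.mem_singleton_iff] at hk ⊢ <;> omega
    | univ => simp
    | inter S T _ _ hS hT =>
      exact fun k hk => ⟨⟨(hS k hk.1).1, (hT k hk.2).1⟩, (hS k hk.1).2, (hT k hk.2).2⟩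
    | sUnion 𝒮 _ ih =>
      rintro k ⟨S, hS, hk⟩
      exact ⟨⟨S, hS, (ih S hS k hk).1⟩, S, hS, (ih S hS k hk).2⟩
  · intro h
    let _ := khalimskyTop
    refine isOpen_iff_forall_mem_open.2 fun x hx => ?_
    obtain ⟨k, rfl | rfl⟩ := x.even_or_odd'
    · refine ⟨{2 * k - 1, 2 * k, 2 * k + 1}, ?_,
        TopologicalSpace.isOpen_generateFrom_of_mem ⟨k, Or.inr rfl⟩, by simp⟩
      rintro y (rfl | rfl | rfl)
      exacts [(h k hx).1, hx, (h k hx).2]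
    · exact ⟨{2 * k + 1}, Set.singleton_subset_iff.2 hx,
        TopologicalSpace.isOpen_generateFrom_of_mem ⟨k, Or.inl rfl⟩, rfl⟩

/-- Two adjacent integers cannot be separated by open sets of the Khalimsky topology. -/
theorem khalimskyTop_adjacent {u v : Set ℤ} (hu : IsOpen[khalimskyTop] u)
    (hv : IsOpen[khalimskyTop] v) {n : ℤ} (hnu : n ∈ u) (hnv : n + 1 ∈ v) :
    n ∈ v ∨ n + 1 ∈ u := by
  rw [isOpen_khalimskyTop_iff] at hu hv
  obtain ⟨k, rfl | rfl⟩ := n.even_or_odd'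
  · exact Or.inr (hu k hnu).2
  · have h := (hv (k + 1) (by convert hnv using 1; ring)).1
    exact Or.inl (by convert h using 1; ring)

theorem khalimskyTop_inter_nonempty_of_le {X u v : Set ℤ}
    (hX : ∀ a ∈ X, ∀ b ∈ X, ∀ c : ℤ, a ≤ c → c ≤ b → c ∈ X)
    (hu : IsOpen[khalimskyTop] u) (hv : IsOpen[khalimskyTop] v) (hcover : X ⊆ u ∪ v)
    {a b : ℤ} (haX : a ∈ X) (hau : a ∈ u) (hbX : b ∈ X) (hbv : b ∈ v) (hab : a ≤ b) :
    (X ∩ (u ∩ v)).Nonempty := by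
  by_contra hne
  have hdisj : ∀ x ∈ X, x ∈ u → x ∉ v := fun x hx hxu hxv => hne ⟨x, hx, hxu, hxv⟩
  have key : ∀ n, a ≤ n → n ∈ X → n ∈ u := by
    intro n hn
    induction n, hn using Int.leInduction with
    | base => exact fun _ => hau
    | succ n hn ih =>
      intro hX'
      have hnX := hX a haX (n + 1) hX' n hn (by omega)
      refine (hcover hX').elim id fun hnv => ?_
      exact (khalimskyTop_adjacent hu hv (ih hnX) hnv).resolve_left (hdisj n hnX (ih hnX))
  exact hdisj b hbX (key b hab hbX) hbv

/-- In the Khalimsky topology on `ℤ`, a subset is connected if and only if it is an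
interval. -/
theorem statement12 (X : Set ℤ) :
    @IsPreconnected ℤ khalimskyTop X ↔
      ∀ a ∈ X, ∀ b ∈ X, ∀ c : ℤ, a ≤ c → c ≤ b → c ∈ X := by
  constructor
  · intro h a ha b hb c hac hcb
    by_contra hc
    have hne : ∀ x ∈ X, x ≠ c := fun x hx hxc => hc (hxc ▸ hx)
    have hac' := hne a ha
    have hbc' := hne b hb
    obtain ⟨j, hj | hj⟩ := c.even_or_odd'
    · obtain ⟨x, -, hx₁, hx₂⟩ := h (Set.Iio c) (Set.Ioi c)
        ((isOpen_khalimskyTop_iff _).2 fun k hk => by simp only [Set.mem_Iio] at *; omega)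
        ((isOpen_khalimskyTop_iff _).2 fun k hk => by simp only [Set.mem_Ioi] at *; omega)
        (fun x hx => lt_or_gt_of_ne (hne x hx))
        ⟨a, ha, lt_of_le_of_ne hac hac'⟩ ⟨b, hb, lt_of_le_of_ne hcb hbc'.symm⟩
      exact lt_asymm (Set.mem_Iio.1 hx₁) (Set.mem_Ioi.1 hx₂)
    · obtain ⟨x, hx, hx₁, hx₂⟩ := h (Set.Iic c) (Set.Ici c)
        ((isOpen_khalimskyTop_iff _).2 fun k hk => by simp only [Set.mem_Iic] at *; omega)
        ((isOpen_khalimskyTop_iff _).2 fun k hk => by simp only [Set.mem_Ici] at *; omega)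
        (fun x _ => le_total x c) ⟨a, ha, hac⟩ ⟨b, hb, hcb⟩
      exact hne x hx (le_antisymm hx₁ hx₂)
  · rintro hX u v hu hv hcover ⟨a, haX, hau⟩ ⟨b, hbX, hbv⟩
    rcases le_total a b with hab | hba
    · exact khalimskyTop_inter_nonempty_of_le hX hu hv hcover haX hau hbX hbv hab
    · rw [Set.inter_comm u v]
      rw [Set.union_comm] at hcover
      exact khalimskyTop_inter_nonempty_of_le hX hv hu hcover hbX hbv haX hau hba
end

section
/- Let f be a homeomorphism of the closed annulus A = 𝕋 × [0,1] isotopic to the identity, f̃ a lift of f to Ã = ℝ × [0,1], and X ⊆ A a nonempty well ordered f-invariant closed set whose rotation number is rational, ρ_{f̃}(X) = p/q with p, q relatively prime and q > 0. Then X contains at least one periodic orbit of type (p,q) for f̃; in particular there exists z ∈ X with f^q(z) = z and f̃^q(z̃) = T^p(z̃) for every z̃ ∈ π⁻¹({z}). -/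
open Set Filter Topology MeasureTheory

noncomputable section

/-- The circle `𝕋 = ℝ/ℤ`. -/
abbrev 𝕋 : Type := AddCircle (1 : ℝ)

/-- The closed annulus `A = 𝕋 × [0,1]`. -/
abbrev Ann : Type := 𝕋 × ↥(Set.Icc (0:ℝ) 1)

/-- The universal cover `Ã = ℝ × [0,1]`. -/
abbrev StripA : Type := ℝ × ↥(Set.Icc (0:ℝ) 1)

/-- The covering projection `π : Ã → A`. -/
def annProj : StripA → Ann := fun z => ((z.1 : 𝕋), z.2)

/-- The deck translation `T(x̃,y) = (x̃+1,y)`. -/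
def deckT : StripA → StripA := fun z => (z.1 + 1, z.2)

/-- The iterated deck translation `T^p`, `p ∈ ℤ`. -/
def deckZ (p : ℤ) : StripA → StripA := fun z => (z.1 + (p : ℝ), z.2)

/-- The boundary circle `C₀ = 𝕋 × {0}`. -/
def C0 : Set Ann := {z | (z.2 : ℝ) = 0}

/-- The boundary circle `C₁ = 𝕋 × {1}`. -/
def C1 : Set Ann := {z | (z.2 : ℝ) = 1}

/-- A point of `Ã` on the boundary line `ℝ × {0}`. -/
def bd0 (x : ℝ) : StripA := (x, ⟨0, by norm_num⟩)

/-- A point of `Ã` on the boundary line `ℝ × {1}`. -/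
def bd1 (x : ℝ) : StripA := (x, ⟨1, by norm_num⟩)

/-- A homeomorphism of the closed annulus isotopic to the identity, together with a
chosen lift to the universal cover.  (A homeomorphism of `A` is isotopic to the identity
iff it admits a lift commuting with the deck translation and preserving each boundary
line of the strip.) -/
structure AnnulusHomeo where
  toFun : Ann ≃ₜ Ann
  lift : StripA ≃ₜ StripA
  lift_proj : ∀ z : StripA, annProj (lift z) = toFun (annProj z)
  lift_deck : ∀ z : StripA, lift (deckT z) = deckT (lift z)
  lift_bd0 : ∀ z : StripA, (z.2 : ℝ) = 0 → ((lift z).2 : ℝ) = 0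

/-- The iterate `f^k`, `k ∈ ℤ`. -/
def AnnulusHomeo.iter (h : AnnulusHomeo) (k : ℤ) : Ann → Ann :=
  fun z => ((h.toFun.toEquiv : Equiv.Perm Ann) ^ k) z

/-- The iterate `f̃^k` of the lift, `k ∈ ℤ`. -/
def AnnulusHomeo.liftIter (h : AnnulusHomeo) (k : ℤ) : StripA → StripA :=
  fun z => ((h.lift.toEquiv : Equiv.Perm StripA) ^ k) z

/-- `f` is non wandering: every nonempty open set meets one of its forward iterates. -/
def NonWandering (h : AnnulusHomeo) : Prop :=
  ∀ U : Set Ann, IsOpen U → U.Nonempty → ∃ k : ℕ, 0 < k ∧ (h.iter k '' U ∩ U).Nonempty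

/-- The closed strip `ℝ × [0,1]` inside the plane. -/
def stripS : Set (ℝ × ℝ) := {p | p.2 ∈ Set.Icc (0:ℝ) 1}

/-- A positive twist map: a `C¹` diffeomorphism of the annulus, isotopic to the identity,
whose lift `F` to the strip (together with its inverse `G`) is continuously differentiable
and satisfies `∂(p̃₁ ∘ f̃)/∂y > 0`, i.e. the first component of `DF(z)·(0,1)` is positive. -/
structure PositiveTwistMap extends AnnulusHomeo where
  F : ℝ × ℝ → ℝ × ℝ
  F' : ℝ × ℝ → (ℝ × ℝ) →L[ℝ] (ℝ × ℝ)
  G : ℝ × ℝ → ℝ × ℝ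
  G' : ℝ × ℝ → (ℝ × ℝ) →L[ℝ] (ℝ × ℝ)
  F_lift : ∀ z : StripA, F (z.1, (z.2 : ℝ)) = ((lift z).1, ((lift z).2 : ℝ))
  G_lift : ∀ z : StripA, G (z.1, (z.2 : ℝ)) = ((lift.symm z).1, ((lift.symm z).2 : ℝ))
  F_hasDeriv : ∀ z ∈ stripS, HasFDerivWithinAt F (F' z) stripS z
  G_hasDeriv : ∀ z ∈ stripS, HasFDerivWithinAt G (G' z) stripS z
  F'_cont : ContinuousOn F' stripS
  G'_cont : ContinuousOn G' stripS
  twist_pos : ∀ z ∈ stripS, 0 < (F' z (0, 1)).1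

/-- The oriented angle (in `(-π, π]`) from the vertical vector `(0,1)` to the vector `w`. -/
def angleFromVertical (w : ℝ × ℝ) : ℝ := Complex.arg ⟨w.2, -w.1⟩

/-- `ρ` is the rotation number of `f` on the boundary circle `C₀`, computed with the lift. -/
def HasRotNum0 (h : AnnulusHomeo) (ρ : ℝ) : Prop :=
  ∀ x : ℝ, Tendsto (fun n : ℕ => ((h.liftIter (n : ℤ) (bd0 x)).1 - x) / (n : ℝ))
    atTop (𝓝 ρ)

/-- `ρ` is the rotation number of `f` on the boundary circle `C₁`, computed with the lift. -/
def HasRotNum1 (h : AnnulusHomeo) (ρ : ℝ) : Prop :=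
  ∀ x : ℝ, Tendsto (fun n : ℕ => ((h.liftIter (n : ℤ) (bd1 x)).1 - x) / (n : ℝ))
    atTop (𝓝 ρ)

/-- A closed `f`-invariant set `X ⊆ A` is well ordered if the first projection is injective
on `X` and the lift preserves the horizontal order on `π⁻¹(X)`. -/
def IsWellOrdered (h : AnnulusHomeo) (X : Set Ann) : Prop :=
  IsClosed X ∧ h.toFun '' X = X ∧
  Set.InjOn (fun z : Ann => z.1) X ∧
  ∀ z₁ z₂ : StripA, annProj z₁ ∈ X → annProj z₂ ∈ X → z₁.1 < z₂.1 →
    (h.lift z₁).1 < (h.lift z₂).1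

/-- An essential simple loop in the annulus: the range of an injective continuous map
from the circle that is not null-homotopic. -/
def IsEssentialSimpleLoop (Γ : Set Ann) : Prop :=
  ∃ γ : C(𝕋, Ann), Function.Injective γ ∧ ¬ γ.Nullhomotopic ∧ Set.range γ = Γ

/-- `Γ` meets each vertical segment `{x} × [0,1]` in exactly one point. -/
def MeetsVerticalsOnce (Γ : Set Ann) : Prop :=
  ∀ x : 𝕋, ∃! z : Ann, z ∈ Γ ∧ z.1 = x

/-- No essential simple loop meeting each vertical segment exactly once is invariant,
except the two boundary circles. -/
def NoInvariantTransverseLoop (h : AnnulusHomeo) : Prop :=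
  ∀ Γ : Set Ann, IsEssentialSimpleLoop Γ → MeetsVerticalsOnce Γ →
    h.toFun '' Γ = Γ → Γ = C0 ∨ Γ = C1

/-- A continuum: a nonempty compact connected set. -/
def IsContinuum (X : Set Ann) : Prop := X.Nonempty ∧ IsCompact X ∧ IsPreconnected X

/-- A lower annulus: an open set homeomorphic to `𝕋 × [0,1)` containing `C₀`. -/
def IsLowerAnnulus (U : Set Ann) : Prop :=
  IsOpen U ∧ Nonempty (↥U ≃ₜ (𝕋 × ↥(Set.Ico (0:ℝ) 1))) ∧ C0 ⊆ U

/-- A lower disk: an open set homeomorphic to `ℝ × [0,1)` meeting `C₀`. -/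
def IsLowerDisk (U : Set Ann) : Prop :=
  IsOpen U ∧ Nonempty (↥U ≃ₜ (ℝ × ↥(Set.Ico (0:ℝ) 1))) ∧ (U ∩ C0).Nonempty

/-- A lower annulus is regular if it is a connected component of the complement of an
essential simple loop. -/
def IsRegularLowerAnnulus (U : Set Ann) : Prop :=
  ∃ Γ : Set Ann, IsEssentialSimpleLoop Γ ∧ ∃ z : Ann, U = connectedComponentIn Γᶜ z

/-- A lower disk is regular if it is a connected component of the complement of a simple
arc joining two points of `C₀` and meeting `C₀` only at its endpoints, or of the
complement of an essential simple loop meeting `C₀` in exactly one point. -/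
def IsRegularLowerDisk (U : Set Ann) : Prop :=
  (∃ a : C(↥(Set.Icc (0:ℝ) 1), Ann), Function.Injective a ∧
      (∀ t : ↥(Set.Icc (0:ℝ) 1), a t ∈ C0 ↔ ((t : ℝ) = 0 ∨ (t : ℝ) = 1)) ∧
      ∃ z : Ann, U = connectedComponentIn (Set.range a)ᶜ z) ∨
  (∃ Γ : Set Ann, IsEssentialSimpleLoop Γ ∧ (∃! z : Ann, z ∈ Γ ∩ C0) ∧
      ∃ z : Ann, U = connectedComponentIn Γᶜ z)

end

/-- A continuous map that preserves the order induced on an invariant closed set by an injective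
continuous function has a fixed point there, provided some orbit starts upwards and stays in a
compact set. -/
theorem exists_fixed_of_le_of_orbit_subset_compact {α : Type*} [TopologicalSpace α] [T2Space α]
    {g : α → α} (hg : Continuous g) {φ : α → ℝ} (hφ : Continuous φ) {Y C : Set α}
    (hY : IsClosed Y) (hC : IsCompact C) (hgY : MapsTo g Y Y) (hinj : InjOn φ Y)
    (hmono : ∀ x ∈ Y, ∀ y ∈ Y, φ x < φ y → φ (g x) < φ (g y))
    {z : α} (hz : z ∈ Y) (horb : ∀ k : ℕ, g^[k] z ∈ C) (hle : φ z ≤ φ (g z)) :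
    ∃ w ∈ Y, g w = w := by
  have hmono' : ∀ x ∈ Y, ∀ y ∈ Y, φ x ≤ φ y → φ (g x) ≤ φ (g y) := by
    intro x hx y hy h
    rcases h.lt_or_eq with h | h
    · exact (hmono x hx y hy h).le
    · rw [hinj hx hy h]
  have hkY : ∀ k : ℕ, g^[k] z ∈ Y := fun k => hgY.iterate k hz
  have hk : ∀ k : ℕ, φ (g^[k] z) ≤ φ (g (g^[k] z)) := by
    intro k
    induction k with
    | zero => exact hle
    | succ k ih =>
      rw [Function.iterate_succ_apply']
      exact hmono' _ (hkY k) _ (hgY (hkY k)) ih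
  set K := closure (range fun k : ℕ => g^[k] z)
  have hKcompact : IsCompact K :=
    hC.of_isClosed_subset isClosed_closure
      (closure_minimal (range_subset_iff.2 horb) hC.isClosed)
  have hKY : K ⊆ Y := closure_minimal (range_subset_iff.2 hkY) hY
  have hKg : MapsTo g K K := by
    refine MapsTo.closure ?_ hg
    rintro _ ⟨k, rfl⟩
    exact ⟨k + 1, Function.iterate_succ_apply' g k z⟩
  have hKle : K ⊆ {x | φ x ≤ φ (g x)} :=
    closure_minimal (range_subset_iff.2 hk) (isClosed_le hφ (hφ.comp hg))
  obtain ⟨w, hwK, hw⟩ :=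
    hKcompact.exists_isMaxOn ⟨z, subset_closure ⟨0, rfl⟩⟩ hφ.continuousOn
  exact ⟨w, hKY hwK, hinj (hKY (hKg hwK)) (hKY hwK) (le_antisymm (hw (hKg hwK)) (hKle hwK))⟩

/-- The deck translation as a permutation of the strip. -/
def deckPerm : Equiv.Perm StripA :=
  (Equiv.addRight (1 : ℝ)).prodCongr (Equiv.refl _)

theorem deckPerm_zpow_apply (m : ℤ) (z : StripA) : (deckPerm ^ m) z = deckZ m z := by
  induction m using Int.induction_on generalizing z with
  | zero => simp [deckZ]
  | succ n ih =>
    rw [zpow_add_one, Equiv.Perm.mul_apply, ih]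
    ext <;> simp [deckZ, deckPerm]
    ring
  | pred n ih =>
    rw [zpow_sub_one, Equiv.Perm.mul_apply, ih]
    have : deckPerm⁻¹ z = (z.1 - 1, z.2) := by
      rw [Equiv.Perm.inv_eq_iff_eq]
      ext <;> simp [deckPerm]
    rw [this]
    ext <;> simp [deckZ]
    ring

theorem continuous_deckZ (m : ℤ) : Continuous (deckZ m) := by
  unfold deckZ
  fun_prop

theorem continuous_annProj : Continuous annProj :=
  ((AddCircle.continuous_mk' (1 : ℝ)).comp continuous_fst).prodMk continuous_snd

theorem annProj_deckZ (m : ℤ) (z : StripA) : annProj (deckZ m z) = annProj z := by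
  have h : ((m : ℝ) : 𝕋) = 0 := (AddCircle.coe_eq_zero_iff (1 : ℝ)).2 ⟨m, by simp⟩
  simp only [annProj, deckZ, AddCircle.coe_add, h, add_zero]

theorem exists_deckZ_of_annProj_eq {z w : StripA} (h : annProj z = annProj w) :
    ∃ m : ℤ, z = deckZ m w := by
  obtain ⟨h₁, h₂⟩ := Prod.ext_iff.1 h
  obtain ⟨m, hm⟩ := (AddCircle.coe_eq_zero_iff (1 : ℝ)).1
    (show ((z.1 - w.1 : ℝ) : 𝕋) = 0 by rw [AddCircle.coe_sub]; exact sub_eq_zero.2 h₁)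
  refine ⟨m, Prod.ext ?_ h₂⟩
  simp only [zsmul_eq_mul, mul_one] at hm
  simp only [deckZ]
  linarith

theorem AnnulusHomeo.commute_lift_deckPerm (f : AnnulusHomeo) :
    Commute (f.lift.toEquiv : Equiv.Perm StripA) deckPerm :=
  Equiv.ext fun z => f.lift_deck z

theorem AnnulusHomeo.annProj_liftIter (f : AnnulusHomeo) (n : ℕ) (z : StripA) :
    annProj (f.liftIter n z) = f.iter n (annProj z) := by
  simp only [liftIter, iter, zpow_natCast]
  induction n with
  | zero => rfl
  | succ n ih =>
    rw [pow_succ', pow_succ', Equiv.Perm.mul_apply, Equiv.Perm.mul_apply, ← ih]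
    exact f.lift_proj _

theorem AnnulusHomeo.continuous_liftIter (f : AnnulusHomeo) (n : ℕ) :
    Continuous (f.liftIter n) := by
  have : f.liftIter n = f.lift^[n] := by
    funext z
    simp only [liftIter, zpow_natCast, ← Equiv.Perm.iterate_eq_pow]
    rfl
  rw [this]
  exact f.lift.continuous.iterate n

theorem IsWellOrdered.injOn_fst {f : AnnulusHomeo} {X : Set Ann} (h : IsWellOrdered f X) :
    InjOn (fun z : StripA => z.1) (annProj ⁻¹' X) := by
  intro z hz w hw hzw
  have : annProj z = annProj w :=
    h.2.2.1 hz hw (show ((z.1 : ℝ) : 𝕋) = ((w.1 : ℝ) : 𝕋) from congrArg _ hzw)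
  exact Prod.ext hzw (Prod.ext_iff.1 this).2

theorem IsWellOrdered.mapsTo_liftIter {f : AnnulusHomeo} {X : Set Ann} (h : IsWellOrdered f X)
    (n : ℕ) : MapsTo (f.liftIter n) (annProj ⁻¹' X) (annProj ⁻¹' X) := by
  intro z hz
  simp only [AnnulusHomeo.liftIter, zpow_natCast]
  induction n with
  | zero => exact hz
  | succ n ih =>
    rw [pow_succ', Equiv.Perm.mul_apply, mem_preimage]
    have := mem_image_of_mem f.toFun (mem_preimage.1 ih)
    rw [h.2.1, ← f.lift_proj] at this
    exact this

theorem IsWellOrdered.liftIter_lt {f : AnnulusHomeo} {X : Set Ann} (h : IsWellOrdered f X)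
    (n : ℕ) {z w : StripA} (hz : annProj z ∈ X) (hw : annProj w ∈ X) (hzw : z.1 < w.1) :
    (f.liftIter n z).1 < (f.liftIter n w).1 := by
  have hmaps := fun n => h.mapsTo_liftIter n
  simp only [AnnulusHomeo.liftIter, zpow_natCast] at hmaps ⊢
  induction n with
  | zero => exact hzw
  | succ n ih =>
    rw [pow_succ', Equiv.Perm.mul_apply, Equiv.Perm.mul_apply]
    exact h.2.2.2 _ _ (hmaps n hz) (hmaps n hw) ih

theorem IsWellOrdered.exists_liftIter_eq_deckZ {f : AnnulusHomeo} {X : Set Ann}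
    (hne : X.Nonempty) (h : IsWellOrdered f X) (p : ℤ) (q : ℕ) (hq : 0 < q)
    (hrot : ∀ z : StripA, annProj z ∈ X → ∀ k : ℤ,
      -1 < (f.liftIter k z).1 - z.1 - (k : ℝ) * ((p : ℝ) / (q : ℝ)) ∧
        (f.liftIter k z).1 - z.1 - (k : ℝ) * ((p : ℝ) / (q : ℝ)) < 1) :
    ∃ w : StripA, annProj w ∈ X ∧ f.liftIter q w = deckZ p w := by
  set g : StripA → StripA := fun z => deckZ (-p) (f.liftIter q z) with hg
  have hgc : Continuous g := (continuous_deckZ _).comp (f.continuous_liftIter q)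
  have hgY : MapsTo g (annProj ⁻¹' X) (annProj ⁻¹' X) := by
    intro z hz
    rw [mem_preimage, hg, annProj_deckZ]
    exact h.mapsTo_liftIter q hz
  have hmono : ∀ x ∈ annProj ⁻¹' X, ∀ y ∈ annProj ⁻¹' X, x.1 < y.1 → (g x).1 < (g y).1 := by
    intro x hx y hy hxy
    simpa [hg, deckZ] using h.liftIter_lt q hx hy hxy
  have hiter : ∀ (k : ℕ) (z : StripA), g^[k] z = deckZ (-p * k) (f.liftIter (q * k : ℕ) z) := by
    intro k z
    have hgp : g = (deckPerm ^ (-p) * (f.lift.toEquiv : Equiv.Perm StripA) ^ q :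
        Equiv.Perm StripA) := by
      funext z
      rw [Equiv.Perm.mul_apply, deckPerm_zpow_apply]
      simp [hg, AnnulusHomeo.liftIter]
    rw [hgp, Equiv.Perm.iterate_eq_pow,
      ((f.commute_lift_deckPerm.symm.zpow_left _).pow_right _).mul_pow, ← pow_mul,
      ← zpow_natCast (deckPerm ^ (-p)), ← zpow_mul, Equiv.Perm.mul_apply, deckPerm_zpow_apply]
    simp only [AnnulusHomeo.liftIter, zpow_natCast]
  obtain ⟨⟨t, y⟩, hx⟩ := hne
  obtain ⟨s, rfl⟩ := QuotientAddGroup.mk_surjective t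
  set z : StripA := (s, y) with hz
  have hzX : annProj z ∈ X := hx
  have hC : IsCompact (Icc (s - 1) (s + 1) ×ˢ (univ : Set ↥(Set.Icc (0:ℝ) 1))) :=
    isCompact_Icc.prod isCompact_univ
  have horb : ∀ k : ℕ, g^[k] z ∈ Icc (s - 1) (s + 1) ×ˢ (univ : Set ↥(Set.Icc (0:ℝ) 1)) := by
    intro k
    obtain ⟨h₁, h₂⟩ := hrot z hzX (q * k : ℕ)
    have hq' : (q : ℝ) ≠ 0 := by positivity
    have he : (((q * k : ℕ) : ℤ) : ℝ) * ((p : ℝ) / q) = p * k := by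
      push_cast
      field_simp
    rw [he] at h₁ h₂
    rw [hiter]
    refine ⟨⟨?_, ?_⟩, mem_univ _⟩ <;> simp only [deckZ] <;> push_cast <;>
      simp only [hz] at h₁ h₂ ⊢ <;> push_cast at h₁ h₂ <;> linarith
  have hY : IsClosed (annProj ⁻¹' X) := h.1.preimage continuous_annProj
  have hfix : ∃ w ∈ annProj ⁻¹' X, g w = w := by
    rcases le_total z.1 (g z).1 with hle | hle
    · exact exists_fixed_of_le_of_orbit_subset_compact hgc continuous_fst hY hC hgY
        h.injOn_fst hmono hzX horb hle
    · refine exists_fixed_of_le_of_orbit_subset_compact (φ := fun z => -z.1) hgc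
        continuous_fst.neg hY hC hgY
        (fun a ha b hb hab => h.injOn_fst ha hb (neg_injective hab)) ?_ hzX horb
        (neg_le_neg hle)
      intro a ha b hb hab
      exact neg_lt_neg (hmono b hb a ha (neg_lt_neg_iff.1 hab))
  obtain ⟨w, hwX, hw⟩ := hfix
  refine ⟨w, hwX, ?_⟩
  change deckZ (-p) (f.liftIter q w) = w at hw
  rw [← deckPerm_zpow_apply, zpow_neg, Equiv.Perm.inv_eq_iff_eq, deckPerm_zpow_apply] at hw
  exact hw

theorem AnnulusHomeo.liftIter_mul_of_eq_deckZ {f : AnnulusHomeo} {n : ℕ} {m : ℤ} {w : StripA}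
    (h : f.liftIter n w = deckZ m w) (k : ℕ) :
    f.liftIter (n * k : ℕ) w = deckZ (m * k) w := by
  rw [← deckPerm_zpow_apply] at h ⊢
  simp only [liftIter, zpow_natCast] at h ⊢
  induction k with
  | zero => simp
  | succ k ih =>
    have hc := (f.commute_lift_deckPerm.pow_left n).zpow_right (m * k)
    rw [Nat.mul_succ, Nat.add_comm, pow_add, Equiv.Perm.mul_apply, ih, ← Equiv.Perm.mul_apply,
      hc.eq, Equiv.Perm.mul_apply, h, ← Equiv.Perm.mul_apply, ← zpow_add]
    push_cast
    rw [mul_add, mul_one]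

/-- A nonempty well ordered invariant closed set with rational rotation number `p/q`
(in lowest terms, `q > 0`) contains a periodic orbit of type `(p,q)` for the lift. -/
theorem statement16 (f : AnnulusHomeo) (X : Set Ann) (hne : X.Nonempty)
    (hwo : IsWellOrdered f X)
    (p : ℤ) (q : ℕ) (hq : 0 < q) (hcop : Nat.Coprime p.natAbs q)
    (hrot : ∀ z : StripA, annProj z ∈ X → ∀ k : ℤ,
      -1 < (f.liftIter k z).1 - z.1 - (k : ℝ) * ((p : ℝ) / (q : ℝ)) ∧
        (f.liftIter k z).1 - z.1 - (k : ℝ) * ((p : ℝ) / (q : ℝ)) < 1) :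
    ∃ z ∈ X, f.iter (q : ℤ) z = z ∧ (∀ j : ℕ, 0 < j → j < q → f.iter (j : ℤ) z ≠ z) ∧
      ∀ w : StripA, annProj w = z → f.liftIter (q : ℤ) w = deckZ p w := by
  obtain ⟨w, hwX, hw⟩ := hwo.exists_liftIter_eq_deckZ hne p q hq hrot
  refine ⟨annProj w, hwX, ?_, ?_, ?_⟩
  · rw [← f.annProj_liftIter, hw, annProj_deckZ]
  · intro j hj hjq hper
    rw [← f.annProj_liftIter] at hper
    obtain ⟨m, hm⟩ := exists_deckZ_of_annProj_eq hper
    have h₁ := AnnulusHomeo.liftIter_mul_of_eq_deckZ hm q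
    have h₂ := AnnulusHomeo.liftIter_mul_of_eq_deckZ hw j
    rw [Nat.mul_comm, h₁] at h₂
    have h₃ : m * (q : ℤ) = p * j := by
      have := congrArg Prod.fst h₂
      simp only [deckZ, add_right_inj] at this
      exact_mod_cast this
    have hdvd : q ∣ p.natAbs * j := by
      have := congrArg Int.natAbs h₃
      simp only [Int.natAbs_mul, Int.natAbs_natCast] at this
      exact ⟨m.natAbs, by rw [← this, Nat.mul_comm]⟩
    exact absurd (Nat.le_of_dvd hj (hcop.symm.dvd_of_dvd_mul_left hdvd)) (not_le.2 hjq)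
  · intro v hv
    obtain ⟨m, rfl⟩ := exists_deckZ_of_annProj_eq hv
    rw [← deckPerm_zpow_apply] at hw
    rw [← deckPerm_zpow_apply p, ← deckPerm_zpow_apply m]
    simp only [AnnulusHomeo.liftIter, zpow_natCast] at hw ⊢
    rw [← Equiv.Perm.mul_apply, ((f.commute_lift_deckPerm.pow_left q).zpow_right m).eq,
      Equiv.Perm.mul_apply, hw, ← Equiv.Perm.mul_apply, ← Equiv.Perm.mul_apply, ← zpow_add,
      ← zpow_add, add_comm]
end
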